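/- arXiv:1407.4477 — 4 statements merged into one kernel-verified Lean document; each statement's English description precedes it below -/
import Mathlib

section
/- Let c(ς) = ∑_{i=1}^{N} ξ_i(ς) for ς ≥ 0, and set ω = min_{1 ≤ i ≤ N} h_i(u_i) and Ω = max_{1 ≤ i ≤ N} h_i(l_i). Then c(ς) = ∑_{i=1}^{N} u_i for all ς ∈ [0, ω], c(ς) = ∑_{i=1}^{N} l_i for all ς ≥ Ω, and for every real γ with ∑_{i=1}^{N} l_i < γ < ∑_{i=1}^{N} u_i there exists ς ∈ [ω, Ω] with c(ς) = γ. (Existence of the water level in Appendix D.) -/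
/-- A right inverse of an injective continuous function on a compact set is continuous. -/
theorem continuousOn_rightInverse_of_isCompact {X Y : Type*} [TopologicalSpace X]
    [TopologicalSpace Y] [T2Space Y] {f : X → Y} {g : Y → X} {s : Set X} {t : Set Y}
    (hs : IsCompact s) (hf : ContinuousOn f s) (hgf : ∀ x ∈ s, g (f x) = x)
    (hfg : ∀ y ∈ t, g y ∈ s ∧ f (g y) = y) : ContinuousOn g t := by
  rw [continuousOn_iff_isClosed]
  intro k hk
  refine ⟨f '' (s ∩ k),
    ((hs.inter_right hk).image_of_continuousOn (hf.mono Set.inter_subset_left)).isClosed, ?_⟩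
  ext y
  constructor
  · rintro ⟨hyk, hyt⟩
    exact ⟨⟨g y, ⟨(hfg y hyt).1, hyk⟩, (hfg y hyt).2⟩, hyt⟩
  · rintro ⟨⟨x, ⟨hxs, hxk⟩, rfl⟩, hyt⟩
    exact ⟨by simpa only [Set.mem_preimage, hgf x hxs] using hxk, hyt⟩


/-- Appendix D: behaviour of `c(ς) = ∑ ξ_i(ς)` and existence of the water level. -/
theorem stmt_9 (N : ℕ) (hN : 0 < N) (l u : Fin N → ℝ) (hlu : ∀ i, l i < u i)
    (h hinv ξ : Fin N → ℝ → ℝ)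
    (hcont : ∀ i, ContinuousOn (h i) (Set.Icc (l i) (u i)))
    (hanti : ∀ i, StrictAntiOn (h i) (Set.Icc (l i) (u i)))
    (hpos : ∀ i, ∀ x ∈ Set.Icc (l i) (u i), 0 < h i x)
    (hinv_left : ∀ i, ∀ x ∈ Set.Icc (l i) (u i), hinv i (h i x) = x)
    (hinv_right : ∀ i, ∀ y ∈ Set.Icc (h i (u i)) (h i (l i)),
      hinv i y ∈ Set.Icc (l i) (u i) ∧ h i (hinv i y) = y)
    (hξ : ∀ i, ∀ ς : ℝ, 0 ≤ ς →
      ξ i ς = if ς < h i (u i) then u i else if ς < h i (l i) then hinv i ς else l i)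
    (ω Ω : ℝ)
    (hω : IsLeast (Set.range fun i => h i (u i)) ω)
    (hΩ : IsGreatest (Set.range fun i => h i (l i)) Ω) :
    (∀ ς ∈ Set.Icc (0 : ℝ) ω, ∑ i, ξ i ς = ∑ i, u i) ∧
    (∀ ς : ℝ, Ω ≤ ς → ∑ i, ξ i ς = ∑ i, l i) ∧
    (∀ γ : ℝ, (∑ i, l i) < γ → γ < ∑ i, u i →
      ∃ ς ∈ Set.Icc ω Ω, ∑ i, ξ i ς = γ) := by
  have hl : ∀ i, l i ∈ Set.Icc (l i) (u i) := fun i => Set.left_mem_Icc.2 (hlu i).le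
  have hu : ∀ i, u i ∈ Set.Icc (l i) (u i) := fun i => Set.right_mem_Icc.2 (hlu i).le
  have hab : ∀ i, h i (u i) < h i (l i) := fun i => hanti i (hl i) (hu i) (hlu i)
  have hω_le : ∀ i, ω ≤ h i (u i) := fun i => hω.2 ⟨i, rfl⟩
  have le_hΩ : ∀ i, h i (l i) ≤ Ω := fun i => hΩ.2 ⟨i, rfl⟩
  have hω_pos : 0 < ω := by
    obtain ⟨i, rfl⟩ := hω.1
    exact hpos i _ (hu i)
  have hωΩ : ω ≤ Ω := (hω_le ⟨0, hN⟩).trans ((hab _).le.trans (le_hΩ _))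
  have hξ_clamp : ∀ i, ∀ ς : ℝ, 0 ≤ ς →
      ξ i ς = hinv i (max (h i (u i)) (min (h i (l i)) ς)) := by
    intro i ς hς
    rw [hξ i ς hς]
    split_ifs with h₁ h₂
    · rw [max_eq_left ((min_le_right _ _).trans h₁.le), hinv_left i _ (hu i)]
    · rw [min_eq_right h₂.le, max_eq_right (not_lt.1 h₁)]
    · rw [min_eq_left (not_lt.1 h₂), max_eq_right (hab i).le, hinv_left i _ (hl i)]
  have hlow : ∀ ς ∈ Set.Icc (0 : ℝ) ω, ∑ i, ξ i ς = ∑ i, u i := by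
    rintro ς ⟨hς, hςω⟩
    refine Finset.sum_congr rfl fun i _ => ?_
    rw [hξ_clamp i ς hς, max_eq_left ((min_le_right _ _).trans (hςω.trans (hω_le i))),
      hinv_left i _ (hu i)]
  have hhigh : ∀ ς : ℝ, Ω ≤ ς → ∑ i, ξ i ς = ∑ i, l i := by
    intro ς hς
    refine Finset.sum_congr rfl fun i _ => ?_
    rw [hξ_clamp i ς (hω_pos.le.trans (hωΩ.trans hς)), min_eq_left ((le_hΩ i).trans hς),
      max_eq_right (hab i).le, hinv_left i _ (hl i)]
  refine ⟨hlow, hhigh, fun γ hγl hγu => ?_⟩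
  have hcontξ : ∀ i, ContinuousOn (ξ i) (Set.Icc ω Ω) := by
    intro i
    have hc : ContinuousOn (hinv i) (Set.Icc (h i (u i)) (h i (l i))) :=
      continuousOn_rightInverse_of_isCompact isCompact_Icc (hcont i) (hinv_left i) (hinv_right i)
    refine (hc.comp (f := fun ς => max (h i (u i)) (min (h i (l i)) ς)) (s := Set.Icc ω Ω)
      (by fun_prop) fun ς _ => ⟨le_max_left _ _, max_le (hab i).le (min_le_left _ _)⟩).congr ?_
    exact fun ς hς => hξ_clamp i ς (hω_pos.le.trans hς.1)
  have hivt := intermediate_value_Icc' hωΩ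
    (continuousOn_finsetSum Finset.univ fun i _ => hcontξ i)
  rw [hlow ω ⟨hω_pos.le, le_rfl⟩, hhigh Ω le_rfl] at hivt
  exact hivt ⟨hγl.le, hγu.le⟩
end

section
/- (Cave-filling optimality.) Suppose σ > 0 satisfies ∑_{n=1}^{N} min{max{1/σ − 1/λ_n, 0}, u_n} = P. Then the point x* with coordinates x*_n = min{max{1/σ − 1/λ_n, 0}, u_n} maximizes x ↦ ∑_{n=1}^{N} log(1 + λ_n x_n) over the set {x ∈ ℝ^N : ∑_{n=1}^{N} x_n ≤ P and 0 ≤ x_n ≤ u_n for every n}. -/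
/-- Clipping the water-filling level `1 / σ - 1 / l` to `[0, u]` gives the maximizer over `[0, u]`
of the Lagrangian `x ↦ log (1 + l * x) - σ * x`. -/
theorem log_one_add_mul_sub_le_clip {l u σ x : ℝ} (hl : 0 < l) (hu : 0 < u) (hσ : 0 < σ)
    (hx : 0 ≤ x) (hxu : x ≤ u) :
    Real.log (1 + l * x) - σ * x ≤
      Real.log (1 + l * min (max (1 / σ - 1 / l) 0) u) -
        σ * min (max (1 / σ - 1 / l) 0) u := by
  set y := min (max (1 / σ - 1 / l) 0) u with hy
  have hy0 : 0 ≤ y := le_min (le_max_right _ _) hu.le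
  have hpos : 0 < 1 + l * y := by positivity
  have hxpos : 0 < 1 + l * x := by positivity
  have hlevel : σ * (1 + l * (1 / σ - 1 / l)) = l := by
    field_simp
    ring
  have hσl : 0 < σ * l := mul_pos hσ hl
  have hstat : 0 ≤ (x - y) * (σ * (1 + l * y) - l) := by
    have hfactor : σ * (1 + l * y) - l = σ * l * (y - (1 / σ - 1 / l)) := by
      linear_combination hlevel
    rw [hfactor, mul_left_comm]
    refine mul_nonneg hσl.le ?_
    rcases le_total (max (1 / σ - 1 / l) 0) u with h | h
    · rw [min_eq_left h] at hy
      rcases le_total (1 / σ - 1 / l) 0 with h' | h'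
      · rw [max_eq_right h'] at hy
        exact mul_nonneg (by linarith) (by linarith)
      · rw [max_eq_left h'] at hy
        simp [hy]
    · rw [min_eq_right h] at hy
      have hle : u ≤ 1 / σ - 1 / l := (le_max_iff.mp h).resolve_right hu.not_ge
      exact mul_nonneg_of_nonpos_of_nonpos (by linarith) (by linarith)
  have hlog := Real.log_le_sub_one_of_pos (div_pos hxpos hpos)
  rw [Real.log_div hxpos.ne' hpos.ne'] at hlog
  have hslope : (1 + l * x) / (1 + l * y) - 1 ≤ σ * (x - y) := by
    rw [div_sub_one hpos.ne', div_le_iff₀ hpos]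
    linarith
  linarith

/-- Cave-filling optimality: the point `x*_n = min{max{1/σ − 1/λ_n, 0}, u_n}` with water
level `1/σ` satisfying the total power constraint maximizes the capacity. -/
theorem stmt_15 (N : ℕ) (hN : 0 < N) (lam u : Fin N → ℝ)
    (hlam : ∀ n, 0 < lam n) (hu : ∀ n, 0 < u n)
    (P : ℝ) (hP : 0 < P) (hPu : P < ∑ n, u n)
    (σ : ℝ) (hσ : 0 < σ)
    (hlevel : ∑ n, min (max (1 / σ - 1 / lam n) 0) (u n) = P) :
    ((∑ n, min (max (1 / σ - 1 / lam n) 0) (u n) ≤ P) ∧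
      (∀ n, 0 ≤ min (max (1 / σ - 1 / lam n) 0) (u n) ∧
        min (max (1 / σ - 1 / lam n) 0) (u n) ≤ u n)) ∧
    ∀ x : Fin N → ℝ, ((∑ n, x n ≤ P) ∧ (∀ n, 0 ≤ x n ∧ x n ≤ u n)) →
      ∑ n, Real.log (1 + lam n * x n) ≤
        ∑ n, Real.log (1 + lam n * min (max (1 / σ - 1 / lam n) 0) (u n)) := by
  refine ⟨⟨hlevel.le, fun n ↦ ⟨le_min (le_max_right _ _) (hu n).le, min_le_right _ _⟩⟩, ?_⟩
  rintro x ⟨hxP, hx⟩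
  have hsum := Finset.sum_le_sum fun n (_ : n ∈ Finset.univ) ↦
    log_one_add_mul_sub_le_clip (hlam n) (hu n) hσ (hx n).1 (hx n).2
  rw [Finset.sum_sub_distrib, Finset.sum_sub_distrib, ← Finset.mul_sum, ← Finset.mul_sum,
    hlevel] at hsum
  linarith [mul_le_mul_of_nonneg_left hxP hσ.le]
end

section
/- (Existence of the cave-filling water level.) If 0 < P < ∑_{n=1}^{N} u_n, then there exists σ > 0 such that ∑_{n=1}^{N} min{max{1/σ − 1/λ_n, 0}, u_n} = P. -/
/-- Existence of the cave-filling water level. -/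
theorem stmt_16 (N : ℕ) (hN : 0 < N) (lam u : Fin N → ℝ)
    (hlam : ∀ n, 0 < lam n) (hu : ∀ n, 0 < u n)
    (P : ℝ) (hP : 0 < P) (hPu : P < ∑ n, u n) :
    ∃ σ : ℝ, 0 < σ ∧ ∑ n, min (max (1 / σ - 1 / lam n) 0) (u n) = P := by
  let f : ℝ → ℝ := fun w => ∑ n, min (max (w - 1 / lam n) 0) (u n)
  have hpos : ∀ n, 0 < u n + 1 / lam n := fun n =>
    add_pos (hu n) (one_div_pos.mpr (hlam n))
  let W : ℝ := ∑ n, (u n + 1 / lam n)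
  have hW : 0 ≤ W := Finset.sum_nonneg fun n _ => (hpos n).le
  have hf : Continuous f := by
    dsimp only [f]
    fun_prop
  have hf0 : f 0 = 0 := by
    refine Finset.sum_eq_zero fun n _ => ?_
    have h := one_div_pos.mpr (hlam n)
    rw [max_eq_right (by linarith), min_eq_left (hu n).le]
  have hfW : f W = ∑ n, u n := by
    refine Finset.sum_congr rfl fun n _ => min_eq_right (le_max_of_le_left ?_)
    have h : u n + 1 / lam n ≤ W :=
      Finset.single_le_sum (f := fun n => u n + 1 / lam n)
        (fun i _ => (hpos i).le) (Finset.mem_univ n)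
    linarith
  obtain ⟨w, ⟨hw0, -⟩, hw⟩ := intermediate_value_Icc hW hf.continuousOn
    (show P ∈ Set.Icc (f 0) (f W) by rw [hf0, hfW]; exact ⟨hP.le, hPu.le⟩)
  have hwpos : 0 < w := by
    refine lt_of_le_of_ne hw0 ?_
    rintro rfl
    exact hP.ne (hf0.symm.trans hw)
  exact ⟨1 / w, one_div_pos.mpr hwpos, by simpa only [one_div_one_div] using hw⟩
end

section
/- (Classical water-filling.) Suppose σ > 0 satisfies ∑_{n=1}^{N} max{1/σ − 1/λ_n, 0} = P. Then the point x* with coordinates x*_n = max{1/σ − 1/λ_n, 0} maximizes x ↦ ∑_{n=1}^{N} log(1 + λ_n x_n) over the set {x ∈ ℝ^N : ∑_{n=1}^{N} x_n ≤ P and x_n ≥ 0 for every n}. -/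
/-- Tangent-line bound for one channel: at the water-filling allocation, the line of slope `σ`
dominates the concave function `x ↦ log (1 + l * x)` on `[0, ∞)`. -/
theorem log_one_add_mul_le_waterFilling {l σ x : ℝ} (hl : 0 < l) (hσ : 0 < σ) (hx : 0 ≤ x) :
    Real.log (1 + l * x) ≤
      Real.log (1 + l * max (1 / σ - 1 / l) 0) + σ * (x - max (1 / σ - 1 / l) 0) := by
  have ha : 0 < 1 + l * x := by positivity
  rcases le_total (1 / σ - 1 / l) 0 with h | h
  · have hls : l ≤ σ := (one_div_le_one_div hσ hl).mp (by linarith)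
    have hlog := Real.log_le_sub_one_of_pos ha
    have hmul := mul_le_mul_of_nonneg_right hls hx
    simp only [max_eq_right h, mul_zero, add_zero, Real.log_one, sub_zero, zero_add]
    linarith
  · rw [max_eq_left h]
    have hb : 1 + l * (1 / σ - 1 / l) = l / σ := by field_simp; ring
    have hlog := Real.log_le_sub_one_of_pos (div_pos ha (div_pos hl hσ))
    rw [Real.log_div ha.ne' (div_pos hl hσ).ne'] at hlog
    have hslope : (1 + l * x) / (l / σ) - 1 = σ * (x - (1 / σ - 1 / l)) := by field_simp; ring
    rw [hb]
    linarith

/-- Classical water-filling: the point `x*_n = max{1/σ − 1/λ_n, 0}` with water level `1/σ`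
satisfying the total power constraint maximizes the capacity. -/
theorem stmt_17 (N : ℕ) (hN : 0 < N) (lam : Fin N → ℝ)
    (hlam : ∀ n, 0 < lam n) (P : ℝ) (hP : 0 < P)
    (σ : ℝ) (hσ : 0 < σ)
    (hlevel : ∑ n, max (1 / σ - 1 / lam n) 0 = P) :
    ((∑ n, max (1 / σ - 1 / lam n) 0 ≤ P) ∧
      (∀ n, 0 ≤ max (1 / σ - 1 / lam n) 0)) ∧
    ∀ x : Fin N → ℝ, ((∑ n, x n ≤ P) ∧ (∀ n, 0 ≤ x n)) →
      ∑ n, Real.log (1 + lam n * x n) ≤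
        ∑ n, Real.log (1 + lam n * max (1 / σ - 1 / lam n) 0) := by
  refine ⟨⟨hlevel.le, fun n => le_max_right _ _⟩, ?_⟩
  rintro x ⟨hxP, hx⟩
  have hsum := Finset.sum_le_sum fun n (_ : n ∈ Finset.univ) =>
    log_one_add_mul_le_waterFilling (hlam n) hσ (hx n)
  rw [Finset.sum_add_distrib, ← Finset.mul_sum, Finset.sum_sub_distrib, hlevel] at hsum
  have hslack := mul_nonpos_of_nonneg_of_nonpos hσ.le (sub_nonpos.mpr hxP)
  linarith
end
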